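/- Two-state rigidity for symmetrized gradients: let p ∈ [1, ∞) and let A, B ∈ ℝ²ˣ² be symmetric matrices such that B − A ≠ a⊙b for all a, b ∈ ℝ². Let (ψ_j) be a sequence of Lipschitz maps ψ_j : ℝ² → ℝ² vanishing outside the open unit ball B₁ ⊂ ℝ², such that ∫_{B₁} dist(𝓔ψ_j(x), {A, B})^p dx → 0 as j → ∞. Then there is a subsequence (ψ_{j_k}) such that either ∫_{B₁} |𝓔ψ_{j_k}(x) − A|^p dx → 0 or ∫_{B₁} |𝓔ψ_{j_k}(x) − B|^p dx → 0. -/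

import Mathlib

open MeasureTheory Filter

/-- The symmetrized gradient `𝓔ψ(x) = (Dψ(x) + Dψ(x)ᵀ)/2` (via `fderiv`; a.e. defined for
Lipschitz maps by Rademacher's theorem). -/
noncomputable def symGradE {d : ℕ} (u : EuclideanSpace ℝ (Fin d) → EuclideanSpace ℝ (Fin d))
    (x : EuclideanSpace ℝ (Fin d)) : Matrix (Fin d) (Fin d) ℝ :=
  fun i j =>
    (fderiv ℝ u x (EuclideanSpace.single j 1) i + fderiv ℝ u x (EuclideanSpace.single i 1) j) / 2

/-- The Frobenius norm of a real matrix. -/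
noncomputable def frob {d : ℕ} (M : Matrix (Fin d) (Fin d) ℝ) : ℝ :=
  Real.sqrt (∑ i, ∑ j, (M i j) ^ 2)

/-- The symmetric tensor product `a ⊙ b := (a ⊗ b + b ⊗ a)/2`. -/
noncomputable def symTensor {d : ℕ} (a b : Fin d → ℝ) : Matrix (Fin d) (Fin d) ℝ :=
  fun i j => (a i * b j + b i * a j) / 2

open scoped Matrix.Norms.Frobenius in
theorem frob_eq_norm {d : ℕ} (M : Matrix (Fin d) (Fin d) ℝ) : frob M = ‖M‖ := by
  rw [Matrix.frobenius_norm_def, frob, Real.sqrt_eq_rpow]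
  simp

theorem frob_nonneg {d : ℕ} (M : Matrix (Fin d) (Fin d) ℝ) : 0 ≤ frob M := Real.sqrt_nonneg _

open scoped Matrix.Norms.Frobenius in
theorem frob_sub_le {d : ℕ} (M N P : Matrix (Fin d) (Fin d) ℝ) :
    frob (M - P) ≤ frob (M - N) + frob (N - P) := by
  simpa only [frob_eq_norm] using norm_sub_le_norm_sub_add_norm_sub M N P

open scoped Matrix.Norms.Frobenius in
theorem frob_le_sub_add {d : ℕ} (M N : Matrix (Fin d) (Fin d) ℝ) :
    frob M ≤ frob (M - N) + frob N := by
  simpa only [frob_eq_norm] using norm_le_norm_sub_add M N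

theorem abs_apply_le_frob {d : ℕ} (M : Matrix (Fin d) (Fin d) ℝ) (i j : Fin d) :
    |M i j| ≤ frob M := by
  refine Real.abs_le_sqrt ?_
  calc (M i j) ^ 2 ≤ ∑ j, (M i j) ^ 2 :=
        Finset.single_le_sum (f := fun j => (M i j) ^ 2) (fun _ _ => sq_nonneg _) (Finset.mem_univ j)
    _ ≤ ∑ i, ∑ j, (M i j) ^ 2 :=
        Finset.single_le_sum (f := fun i => ∑ j, (M i j) ^ 2)
          (fun _ _ => Finset.sum_nonneg fun _ _ => sq_nonneg _) (Finset.mem_univ i)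

theorem measurable_symGradE_apply {d : ℕ}
    (u : EuclideanSpace ℝ (Fin d) → EuclideanSpace ℝ (Fin d)) (i j : Fin d) :
    Measurable fun x => symGradE u x i j := by
  unfold symGradE
  have h : ∀ v : EuclideanSpace ℝ (Fin d), ∀ i, Measurable fun x => fderiv ℝ u x v i := fun v i =>
    (EuclideanSpace.proj (𝕜 := ℝ) i).continuous.measurable.comp (measurable_fderiv_apply_const ℝ u v)
  exact ((h _ _).add (h _ _)).div_const _

theorem measurable_frob_symGradE_sub {d : ℕ}
    (u : EuclideanSpace ℝ (Fin d) → EuclideanSpace ℝ (Fin d)) (A : Matrix (Fin d) (Fin d) ℝ) :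
    Measurable fun x => frob (symGradE u x - A) := by
  unfold frob
  have := measurable_symGradE_apply u
  refine Real.continuous_sqrt.measurable.comp ?_
  refine Finset.measurable_sum _ fun i _ => Finset.measurable_sum _ fun j _ => ?_
  exact ((this i j).sub_const _).pow_const 2

theorem measurable_frob_symGradE {d : ℕ}
    (u : EuclideanSpace ℝ (Fin d) → EuclideanSpace ℝ (Fin d)) :
    Measurable fun x => frob (symGradE u x) := by
  simpa using measurable_frob_symGradE_sub u 0

theorem apply_eq_sum_single {d : ℕ} (L : EuclideanSpace ℝ (Fin 2) →L[ℝ] EuclideanSpace ℝ (Fin d))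
    (h : EuclideanSpace ℝ (Fin 2)) :
    L h = h 0 • L (EuclideanSpace.single 0 1) + h 1 • L (EuclideanSpace.single 1 1) := by
  rw [← map_smul, ← map_smul, ← map_add]
  congr 1
  ext i
  fin_cases i <;> simp

theorem abs_inner_fderiv_le_frob (u : EuclideanSpace ℝ (Fin 2) → EuclideanSpace ℝ (Fin 2))
    (x h : EuclideanSpace ℝ (Fin 2)) :
    |inner ℝ (fderiv ℝ u x h) h| ≤ frob (symGradE u x) * ‖h‖ ^ 2 := by
  have h1 : 0 ≤ ‖h‖ ^ 2 := by positivity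
  rw [frob, ← Real.sqrt_sq h1, ← Real.sqrt_mul (by positivity)]
  refine Real.abs_le_sqrt ?_
  rw [apply_eq_sum_single, EuclideanSpace.norm_sq_eq]
  simp only [symGradE, Fin.sum_univ_two, Real.norm_eq_abs, sq_abs, PiLp.inner_apply,
    PiLp.add_apply, PiLp.smul_apply, smul_eq_mul, RCLike.inner_apply, conj_trivial]
  generalize (fderiv ℝ u x (EuclideanSpace.single 0 1)) 0 = a
  generalize (fderiv ℝ u x (EuclideanSpace.single 0 1)) 1 = b
  generalize (fderiv ℝ u x (EuclideanSpace.single 1 1)) 0 = c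
  generalize (fderiv ℝ u x (EuclideanSpace.single 1 1)) 1 = d
  generalize h 0 = p
  generalize h 1 = q
  have e : ((a + a) / 2) ^ 2 + ((c + b) / 2) ^ 2 + (((b + c) / 2) ^ 2 + ((d + d) / 2) ^ 2)
      = a ^ 2 + 2 * ((b + c) / 2) ^ 2 + d ^ 2 := by ring
  rw [e]
  have e2 : p * (p * a + q * c) + q * (p * b + q * d)
      = a * p ^ 2 + 2 * ((b + c) / 2) * (p * q) + d * q ^ 2 := by ring
  rw [e2]
  generalize (b + c) / 2 = s
  nlinarith [sq_nonneg (a * (p * q) - s * p ^ 2), sq_nonneg (a * q ^ 2 - d * p ^ 2),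
    sq_nonneg (s * q ^ 2 - d * (p * q))]

theorem symGradE_eq_zero {u : EuclideanSpace ℝ (Fin 2) → EuclideanSpace ℝ (Fin 2)}
    (hu : ∀ x, 1 ≤ ‖x‖ → u x = 0) {x : EuclideanSpace ℝ (Fin 2)} (hx : 1 < ‖x‖) :
    symGradE u x = 0 := by
  have : u =ᶠ[nhds x] fun _ => 0 := by
    filter_upwards [(isOpen_lt continuous_const continuous_norm).mem_nhds hx] with y hy
    exact hu y (le_of_lt hy)
  have h2 : fderiv ℝ u x = 0 := by rw [this.fderiv_eq]; simp
  ext i j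
  simp [symGradE, h2]

theorem inner_sub_le_lintegral_frob {K : NNReal}
    {u : EuclideanSpace ℝ (Fin 2) → EuclideanSpace ℝ (Fin 2)} (hu : LipschitzWith K u)
    (x h : EuclideanSpace ℝ (Fin 2))
    (hd : ∀ᵐ t ∂(volume.restrict (Set.Ioc (0 : ℝ) 1)), DifferentiableAt ℝ u (x + t • h)) :
    ENNReal.ofReal |inner ℝ (u (x + h) - u x) h| ≤
      ENNReal.ofReal (‖h‖ ^ 2) *
        ∫⁻ t in Set.Ioc (0 : ℝ) 1, ENNReal.ofReal (frob (symGradE u (x + t • h))) := by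
  set g : ℝ → ℝ := fun t => inner ℝ (u (x + t • h)) h with hg
  have hglip : LipschitzWith (K * ‖h‖₊ * ‖h‖₊) g := by
    refine LipschitzWith.of_dist_le_mul fun s t => ?_
    rw [hg, Real.dist_eq, ← inner_sub_left]
    refine (abs_real_inner_le_norm _ _).trans ?_
    have := hu.dist_le_mul (x + s • h) (x + t • h)
    rw [dist_eq_norm, dist_add_left, dist_eq_norm, ← sub_smul, norm_smul] at this
    rw [Real.dist_eq]
    push_cast
    rw [Real.norm_eq_abs] at this
    nlinarith [norm_nonneg h]
  have hac := (hglip.lipschitzOnWith (s := Set.uIcc 0 1)).absolutelyContinuousOnInterval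
  have hftc := hac.integral_deriv_eq_sub
  have hval : inner ℝ (u (x + h) - u x) h = ∫ t in Set.Ioc (0 : ℝ) 1, deriv g t := by
    rw [← intervalIntegral.integral_of_le zero_le_one, hftc, inner_sub_left]
    simp [hg]
  rw [hval, ← Real.enorm_eq_ofReal_abs]
  refine (enorm_integral_le_lintegral_enorm _).trans ?_
  rw [← lintegral_const_mul' _ _ ENNReal.ofReal_ne_top]
  refine lintegral_mono_ae ?_
  filter_upwards [hd] with t ht
  have hder : HasDerivAt g (inner ℝ (fderiv ℝ u (x + t • h) h) h) t := by
    have h1 : HasDerivAt (fun t : ℝ => x + t • h) h t := by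
      simpa using ((hasDerivAt_id t).smul_const h).const_add x
    have h2 := ht.hasFDerivAt.comp_hasDerivAt t h1
    simpa using h2.inner ℝ (hasDerivAt_const t h)
  rw [hder.deriv, Real.enorm_eq_ofReal_abs, ← ENNReal.ofReal_mul (by positivity)]
  refine ENNReal.ofReal_le_ofReal ?_
  rw [mul_comm]
  exact abs_inner_fderiv_le_frob u _ h

theorem ofReal_sq_mul_setLIntegral_ball_comp {F : EuclideanSpace ℝ (Fin 2) → ENNReal}
    (hF : Measurable F) (x : EuclideanSpace ℝ (Fin 2)) {t : ℝ} (ht : 0 < t) (R : ℝ) :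
    ENNReal.ofReal (t ^ 2) * ∫⁻ h in Metric.ball 0 R, F (x + t • h) =
      ∫⁻ y in Metric.ball x (t * R), F y := by
  have hm := Measure.map_addHaar_smul (volume : Measure (EuclideanSpace ℝ (Fin 2))) ht.ne'
  rw [finrank_euclideanSpace_fin, abs_of_nonneg (by positivity)] at hm
  rw [← lintegral_indicator Metric.isOpen_ball.measurableSet,
    ← lintegral_indicator Metric.isOpen_ball.measurableSet,
    ← lintegral_add_left_eq_self ((Metric.ball x (t * R)).indicator F) x]
  set G : EuclideanSpace ℝ (Fin 2) → ENNReal :=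
    fun y => (Metric.ball x (t * R)).indicator F (x + y) with hG
  have hGm : Measurable G :=
    (hF.indicator Metric.isOpen_ball.measurableSet).comp (measurable_const_add x)
  have h1 : (fun h => (Metric.ball (0 : EuclideanSpace ℝ (Fin 2)) R).indicator
      (fun h => F (x + t • h)) h) = fun h => G (t • h) := by
    funext h
    have : h ∈ Metric.ball (0 : EuclideanSpace ℝ (Fin 2)) R ↔
        x + t • h ∈ Metric.ball x (t * R) := by
      rw [mem_ball_zero_iff, Metric.mem_ball, dist_self_add_left, norm_smul, Real.norm_eq_abs,
        abs_of_pos ht, mul_lt_mul_iff_right₀ ht]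
    by_cases hh : h ∈ Metric.ball (0 : EuclideanSpace ℝ (Fin 2)) R
    · simp only [hG, Set.indicator_of_mem hh, Set.indicator_of_mem (this.1 hh)]
    · simp only [hG, Set.indicator_of_notMem hh, Set.indicator_of_notMem (mt this.2 hh)]
  rw [h1, ← lintegral_map hGm (measurable_const_smul t), hm, lintegral_smul_measure, smul_eq_mul,
    ← mul_assoc, ← ENNReal.ofReal_mul (by positivity), mul_inv_cancel₀ (by positivity),
    ENNReal.ofReal_one, one_mul]

theorem setLIntegral_ball_inner_sub_le {K : NNReal}
    {u : EuclideanSpace ℝ (Fin 2) → EuclideanSpace ℝ (Fin 2)} (hu : LipschitzWith K u)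
    {x : EuclideanSpace ℝ (Fin 2)} {Λ : ℝ}
    (hx : ∀ r > 0, ∫⁻ y in Metric.ball x r, ENNReal.ofReal (frob (symGradE u y)) ≤
      ENNReal.ofReal (Λ * r ^ 2)) {R : ℝ} (hR : 0 < R) :
    ∫⁻ h in Metric.ball 0 R, ENNReal.ofReal |inner ℝ (u (x + h) - u x) h| ≤
      ENNReal.ofReal (Λ * R ^ 4) := by
  set F : EuclideanSpace ℝ (Fin 2) → ENNReal :=
    fun y => ENNReal.ofReal (frob (symGradE u y)) with hF
  have hFm : Measurable F := (measurable_frob_symGradE u).ennreal_ofReal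
  have hmap : Measurable fun q : EuclideanSpace ℝ (Fin 2) × ℝ => x + q.2 • q.1 := by fun_prop
  have hae : ∀ᵐ h : EuclideanSpace ℝ (Fin 2), ∀ᵐ t ∂(volume.restrict (Set.Ioc (0 : ℝ) 1)),
      DifferentiableAt ℝ u (x + t • h) := by
    rw [Measure.ae_ae_comm (p := fun h t => DifferentiableAt ℝ u (x + t • h))
      (hmap (measurableSet_of_differentiableAt ℝ u))]
    refine (ae_restrict_iff' measurableSet_Ioc).2 (Eventually.of_forall fun t ht => ?_)
    have h0 : volume {y | ¬ DifferentiableAt ℝ u y} = 0 := hu.ae_differentiableAt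
    have h1 : volume ((fun y => x + y) ⁻¹' {y | ¬ DifferentiableAt ℝ u y}) = 0 := by
      rw [measure_preimage_add, h0]
    have h2 := Measure.addHaar_preimage_smul
      (volume : Measure (EuclideanSpace ℝ (Fin 2))) ht.1.ne'
      ((fun y => x + y) ⁻¹' {y | ¬ DifferentiableAt ℝ u y})
    rw [h1, mul_zero] at h2
    exact h2
  calc ∫⁻ h in Metric.ball 0 R, ENNReal.ofReal |inner ℝ (u (x + h) - u x) h|
      ≤ ∫⁻ h in Metric.ball 0 R, ENNReal.ofReal (R ^ 2) *
          ∫⁻ t in Set.Ioc (0 : ℝ) 1, F (x + t • h) := by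
        refine lintegral_mono_ae ?_
        filter_upwards [ae_restrict_of_ae hae, ae_restrict_mem Metric.isOpen_ball.measurableSet]
          with h hd hh
        refine (inner_sub_le_lintegral_frob hu x h hd).trans ?_
        gcongr
        exact (mem_ball_zero_iff.1 hh).le
    _ = ENNReal.ofReal (R ^ 2) * ∫⁻ t in Set.Ioc (0 : ℝ) 1, ∫⁻ h in Metric.ball 0 R,
          F (x + t • h) := by
        rw [lintegral_const_mul' _ _ ENNReal.ofReal_ne_top, lintegral_lintegral_swap]
        exact (hFm.comp hmap).aemeasurable
    _ ≤ ENNReal.ofReal (R ^ 2) * ∫⁻ t in Set.Ioc (0 : ℝ) 1, ENNReal.ofReal (Λ * R ^ 2) := by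
        gcongr ENNReal.ofReal (R ^ 2) * ?_
        refine setLIntegral_mono measurable_const fun t ht => ?_
        have h1 := ofReal_sq_mul_setLIntegral_ball_comp hFm x ht.1 R
        have h2 := hx (t * R) (mul_pos ht.1 hR)
        rw [← h1, show Λ * (t * R) ^ 2 = t ^ 2 * (Λ * R ^ 2) by ring,
          ENNReal.ofReal_mul (by positivity)] at h2
        have ht2 : 0 < t ^ 2 := pow_pos ht.1 2
        exact (ENNReal.mul_le_mul_iff_right (by simpa using ht.1.ne') ENNReal.ofReal_ne_top).1 h2
    _ = ENNReal.ofReal (Λ * R ^ 4) := by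
        rw [setLIntegral_const, Real.volume_Ioc, sub_zero, ENNReal.ofReal_one, mul_one,
          ← ENNReal.ofReal_mul (by positivity)]
        congr 1
        ring

theorem setLIntegral_ball_inner_add_sub_le {K : NNReal}
    {u : EuclideanSpace ℝ (Fin 2) → EuclideanSpace ℝ (Fin 2)} (hu : LipschitzWith K u)
    {y : EuclideanSpace ℝ (Fin 2)} {Λ : ℝ}
    (hy : ∀ r > 0, ∫⁻ z in Metric.ball y r, ENNReal.ofReal (frob (symGradE u z)) ≤
      ENNReal.ofReal (Λ * r ^ 2)) (d : EuclideanSpace ℝ (Fin 2)) (hd : 0 < ‖d‖) :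
    ∫⁻ h in Metric.ball 0 ‖d‖, ENNReal.ofReal |inner ℝ (u (y + h + d) - u (y + h)) d| ≤
      ENNReal.ofReal (4 * Λ * ‖d‖ ^ 4) := by
  set F : EuclideanSpace ℝ (Fin 2) → ENNReal :=
    fun y => ENNReal.ofReal (frob (symGradE u y)) with hF
  have hFm : Measurable F := (measurable_frob_symGradE u).ennreal_ofReal
  have hmap : Measurable fun q : EuclideanSpace ℝ (Fin 2) × ℝ => y + q.1 + q.2 • d := by fun_prop
  have hae : ∀ᵐ h : EuclideanSpace ℝ (Fin 2), ∀ᵐ t ∂(volume.restrict (Set.Ioc (0 : ℝ) 1)),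
      DifferentiableAt ℝ u (y + h + t • d) := by
    rw [Measure.ae_ae_comm (p := fun h t => DifferentiableAt ℝ u (y + h + t • d))
      (hmap (measurableSet_of_differentiableAt ℝ u))]
    refine Eventually.of_forall fun t => ?_
    have h0 : volume {y | ¬ DifferentiableAt ℝ u y} = 0 := hu.ae_differentiableAt
    have h1 : volume ((fun h => (y + t • d) + h) ⁻¹' {y | ¬ DifferentiableAt ℝ u y}) = 0 := by
      rw [measure_preimage_add, h0]
    rw [ae_iff]
    convert h1 using 3
    simp only [add_right_comm]
    rfl
  have hball (t : ℝ) (ht : t ∈ Set.Ioc (0 : ℝ) 1) :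
      ∫⁻ h in Metric.ball 0 ‖d‖, F (y + h + t • d) ≤ ENNReal.ofReal (Λ * (2 * ‖d‖) ^ 2) := by
    refine le_trans ?_ (hy (2 * ‖d‖) (by positivity))
    rw [← lintegral_indicator Metric.isOpen_ball.measurableSet,
      ← lintegral_indicator Metric.isOpen_ball.measurableSet,
      ← lintegral_add_left_eq_self ((Metric.ball y (2 * ‖d‖)).indicator F) (y + t • d)]
    refine lintegral_mono (Set.indicator_le fun h hh => ?_)
    rw [Set.indicator_of_mem, add_right_comm]
    rw [Metric.mem_ball, dist_eq_norm]
    have : y + t • d + h - y = t • d + h := by abel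
    rw [this]
    have h1 := norm_add_le (t • d) h
    rw [norm_smul, Real.norm_eq_abs, abs_of_pos ht.1] at h1
    have h2 := mem_ball_zero_iff.1 hh
    nlinarith [ht.2]
  calc ∫⁻ h in Metric.ball 0 ‖d‖, ENNReal.ofReal |inner ℝ (u (y + h + d) - u (y + h)) d|
      ≤ ∫⁻ h in Metric.ball 0 ‖d‖, ENNReal.ofReal (‖d‖ ^ 2) *
          ∫⁻ t in Set.Ioc (0 : ℝ) 1, F (y + h + t • d) := by
        refine lintegral_mono_ae ?_
        filter_upwards [ae_restrict_of_ae hae] with h hdiff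
        exact inner_sub_le_lintegral_frob hu (y + h) d hdiff
    _ = ENNReal.ofReal (‖d‖ ^ 2) * ∫⁻ t in Set.Ioc (0 : ℝ) 1, ∫⁻ h in Metric.ball 0 ‖d‖,
          F (y + h + t • d) := by
        rw [lintegral_const_mul' _ _ ENNReal.ofReal_ne_top, lintegral_lintegral_swap]
        exact (hFm.comp hmap).aemeasurable
    _ ≤ ENNReal.ofReal (‖d‖ ^ 2) *
          ∫⁻ t in Set.Ioc (0 : ℝ) 1, ENNReal.ofReal (Λ * (2 * ‖d‖) ^ 2) := by
        gcongr ENNReal.ofReal (‖d‖ ^ 2) * ?_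
        exact setLIntegral_mono measurable_const hball
    _ = ENNReal.ofReal (4 * Λ * ‖d‖ ^ 4) := by
        rw [setLIntegral_const, Real.volume_Ioc, sub_zero, ENNReal.ofReal_one, mul_one,
          ← ENNReal.ofReal_mul (by positivity)]
        congr 1
        ring

/-- If the averages of the symmetrized gradient at all scales around two points are at most `Λ`
(up to normalization), then the stretching between these points is controlled by `Λ`. The
proof averages the parallelogram identity for the stretching over the vertices
`x, y, x + h, y + h`. -/
theorem abs_inner_sub_le_of_average_le {K : NNReal}
    {u : EuclideanSpace ℝ (Fin 2) → EuclideanSpace ℝ (Fin 2)} (hu : LipschitzWith K u)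
    {x y : EuclideanSpace ℝ (Fin 2)} {Λ : ℝ} (hΛ : 0 ≤ Λ)
    (hx : ∀ r > 0, ∫⁻ z in Metric.ball x r, ENNReal.ofReal (frob (symGradE u z)) ≤
      ENNReal.ofReal (Λ * r ^ 2))
    (hy : ∀ r > 0, ∫⁻ z in Metric.ball y r, ENNReal.ofReal (frob (symGradE u z)) ≤
      ENNReal.ofReal (Λ * r ^ 2)) :
    |inner ℝ (u x - u y) (x - y)| ≤ 23 * Λ * ‖x - y‖ ^ 2 := by
  rcases eq_or_ne x y with rfl | hne
  · simp
  obtain ⟨d, rfl⟩ : ∃ d, x = y + d := ⟨x - y, by abel⟩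
  have hd : 0 < ‖d‖ := norm_pos_iff.2 fun h => hne (by simp [h])
  rw [add_sub_cancel_left]
  have hcont := hu.continuous
  have key (z : EuclideanSpace ℝ (Fin 2)) (c : EuclideanSpace ℝ (Fin 2)) (hc : ‖c‖ ≤ ‖d‖)
      (hz : ∀ r > 0, ∫⁻ w in Metric.ball z r, ENNReal.ofReal (frob (symGradE u w)) ≤
        ENNReal.ofReal (Λ * r ^ 2)) :
      ∫⁻ h in Metric.ball 0 ‖d‖, ENNReal.ofReal |inner ℝ (u (z + (c + h)) - u z) (c + h)| ≤
        ENNReal.ofReal (16 * Λ * ‖d‖ ^ 4) := by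
    have h1 := setLIntegral_ball_inner_sub_le hu hz (R := 2 * ‖d‖) (by positivity)
    rw [show Λ * (2 * ‖d‖) ^ 4 = 16 * Λ * ‖d‖ ^ 4 by ring] at h1
    refine le_trans ?_ h1
    set G : EuclideanSpace ℝ (Fin 2) → ENNReal :=
      fun h => ENNReal.ofReal |inner ℝ (u (z + h) - u z) h|
    rw [← lintegral_indicator Metric.isOpen_ball.measurableSet,
      ← lintegral_indicator Metric.isOpen_ball.measurableSet,
      ← lintegral_add_left_eq_self ((Metric.ball 0 (2 * ‖d‖)).indicator G) c]
    refine lintegral_mono (Set.indicator_le fun h hh => ?_)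
    rw [Set.indicator_of_mem]
    rw [mem_ball_zero_iff] at hh ⊢
    linarith [norm_add_le c h]
  set a1 : EuclideanSpace ℝ (Fin 2) → ℝ := fun h => |inner ℝ (u (y + (d + h)) - u y) (d + h)|
  set a2 : EuclideanSpace ℝ (Fin 2) → ℝ :=
    fun h => |inner ℝ (u (y + d + (-d + h)) - u (y + d)) (-d + h)|
  set a3 : EuclideanSpace ℝ (Fin 2) → ℝ :=
    fun h => |inner ℝ (u (y + d + (0 + h)) - u (y + d)) (0 + h)|
  set a4 : EuclideanSpace ℝ (Fin 2) → ℝ := fun h => |inner ℝ (u (y + (0 + h)) - u y) (0 + h)|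
  set a5 : EuclideanSpace ℝ (Fin 2) → ℝ := fun h => |inner ℝ (u (y + h + d) - u (y + h)) d|
  have hm1 : Measurable fun h => ENNReal.ofReal (a1 h) := by
    have : Continuous a1 := by fun_prop
    exact this.measurable.ennreal_ofReal
  have hm2 : Measurable fun h => ENNReal.ofReal (a2 h) := by
    have : Continuous a2 := by fun_prop
    exact this.measurable.ennreal_ofReal
  have hm3 : Measurable fun h => ENNReal.ofReal (a3 h) := by
    have : Continuous a3 := by fun_prop
    exact this.measurable.ennreal_ofReal
  have hm4 : Measurable fun h => ENNReal.ofReal (a4 h) := by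
    have : Continuous a4 := by fun_prop
    exact this.measurable.ennreal_ofReal
  have hpt (h : EuclideanSpace ℝ (Fin 2)) :
      |inner ℝ (u (y + d) - u y) d| ≤ a1 h + (a2 h + (a3 h + (a4 h + a5 h))) := by
    have e1 : y + (d + h) = y + h + d := by abel
    have e2 : y + d + (-d + h) = y + h := by abel
    have e3 : y + d + (0 + h) = y + h + d := by abel
    have e4 : y + (0 + h) = y + h := by abel
    have : inner ℝ (u (y + d) - u y) d =
        inner ℝ (u (y + (d + h)) - u y) (d + h)
        + inner ℝ (u (y + d + (-d + h)) - u (y + d)) (-d + h)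
        - inner ℝ (u (y + d + (0 + h)) - u (y + d)) (0 + h)
        - inner ℝ (u (y + (0 + h)) - u y) (0 + h)
        - inner ℝ (u (y + h + d) - u (y + h)) d := by
      rw [e1, e2, e3, e4, zero_add]
      simp only [inner_sub_left, inner_add_right, inner_neg_right]
      ring
    rw [this]
    refine (abs_sub _ _).trans ?_
    have b1 := abs_sub (inner ℝ (u (y + (d + h)) - u y) (d + h)
        + inner ℝ (u (y + d + (-d + h)) - u (y + d)) (-d + h)
        - inner ℝ (u (y + d + (0 + h)) - u (y + d)) (0 + h))
        (inner ℝ (u (y + (0 + h)) - u y) (0 + h))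
    have b2 := abs_sub (inner ℝ (u (y + (d + h)) - u y) (d + h)
        + inner ℝ (u (y + d + (-d + h)) - u (y + d)) (-d + h))
        (inner ℝ (u (y + d + (0 + h)) - u (y + d)) (0 + h))
    have b3 := abs_add_le (inner ℝ (u (y + (d + h)) - u y) (d + h))
        (inner ℝ (u (y + d + (-d + h)) - u (y + d)) (-d + h))
    simp only [a1, a2, a3, a4, a5]
    linarith
  have hint : ENNReal.ofReal |inner ℝ (u (y + d) - u y) d| *
      volume (Metric.ball (0 : EuclideanSpace ℝ (Fin 2)) ‖d‖) ≤
      ENNReal.ofReal (68 * Λ * ‖d‖ ^ 4) := by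
    rw [← setLIntegral_const]
    calc ∫⁻ _ in Metric.ball (0 : EuclideanSpace ℝ (Fin 2)) ‖d‖,
          ENNReal.ofReal |inner ℝ (u (y + d) - u y) d|
        ≤ ∫⁻ h in Metric.ball (0 : EuclideanSpace ℝ (Fin 2)) ‖d‖,
          (ENNReal.ofReal (a1 h) + (ENNReal.ofReal (a2 h) + (ENNReal.ofReal (a3 h) +
            (ENNReal.ofReal (a4 h) + ENNReal.ofReal (a5 h))))) := by
          refine lintegral_mono fun h => ?_
          rw [← ENNReal.ofReal_add (abs_nonneg _) (abs_nonneg _),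
            ← ENNReal.ofReal_add (abs_nonneg _) (by positivity),
            ← ENNReal.ofReal_add (abs_nonneg _) (by positivity),
            ← ENNReal.ofReal_add (abs_nonneg _) (by positivity)]
          exact ENNReal.ofReal_le_ofReal (hpt h)
      _ ≤ ENNReal.ofReal (16 * Λ * ‖d‖ ^ 4) + (ENNReal.ofReal (16 * Λ * ‖d‖ ^ 4) +
          (ENNReal.ofReal (16 * Λ * ‖d‖ ^ 4) + (ENNReal.ofReal (16 * Λ * ‖d‖ ^ 4) +
            ENNReal.ofReal (4 * Λ * ‖d‖ ^ 4)))) := by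
          rw [lintegral_add_left hm1, lintegral_add_left hm2, lintegral_add_left hm3,
            lintegral_add_left hm4]
          gcongr
          · exact key y d le_rfl hy
          · exact key (y + d) (-d) (by simp) hx
          · exact key (y + d) 0 (by simp) hx
          · exact key y 0 (by simp) hy
          · exact setLIntegral_ball_inner_add_sub_le hu hy d hd
      _ = ENNReal.ofReal (68 * Λ * ‖d‖ ^ 4) := by
          rw [← ENNReal.ofReal_add (by positivity) (by positivity),
            ← ENNReal.ofReal_add (by positivity) (by positivity),
            ← ENNReal.ofReal_add (by positivity) (by positivity),
            ← ENNReal.ofReal_add (by positivity) (by positivity)]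
          congr 1
          ring
  rw [EuclideanSpace.volume_ball_fin_two, ← ENNReal.ofReal_pow hd.le,
    ← ENNReal.ofReal_mul (by positivity), ← ENNReal.ofReal_mul (by positivity),
    ENNReal.ofReal_le_ofReal_iff (by positivity)] at hint
  have hd2 : 0 < ‖d‖ ^ 2 := by positivity
  have h3 : |inner ℝ (u (y + d) - u y) d| * Real.pi ≤ 68 * Λ * ‖d‖ ^ 2 := by
    refine le_of_mul_le_mul_right ?_ hd2
    calc _ = |inner ℝ (u (y + d) - u y) d| * (‖d‖ ^ 2 * Real.pi) := by ring
      _ ≤ _ := hint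
      _ = _ := by ring
  nlinarith [Real.pi_gt_three, abs_nonneg (inner ℝ (u (y + d) - u y) d), mul_nonneg hΛ hd2.le]

/-- A weak-type estimate for the maximal function in the plane, from Vitali's covering lemma. -/
theorem volume_exists_lt_setLIntegral_closedBall_le
    (e : EuclideanSpace ℝ (Fin 2) → ENNReal) {I : ℝ} (hI : ∫⁻ x, e x ≤ ENNReal.ofReal I) :
    volume {x | ∃ r > 0, ENNReal.ofReal (r ^ 2) < ∫⁻ y in Metric.closedBall x r, e y} ≤
      ENNReal.ofReal (64 * I) := by
  set S : Set (EuclideanSpace ℝ (Fin 2)) :=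
    {x | ∃ r > 0, ENNReal.ofReal (r ^ 2) < ∫⁻ y in Metric.closedBall x r, e y}
  have hS : ∀ x : S, ∃ r > 0,
      ENNReal.ofReal (r ^ 2) < ∫⁻ y in Metric.closedBall (x : EuclideanSpace ℝ (Fin 2)) r, e y :=
    fun x => x.2
  choose r hr0 hr using hS
  have hrb : ∀ x ∈ (Set.univ : Set S), r x ≤ Real.sqrt I := by
    intro x _
    refine Real.le_sqrt_of_sq_le ?_
    have h1 := (hr x).trans_le ((setLIntegral_le_lintegral _ _).trans hI)
    exact ((ENNReal.ofReal_lt_ofReal_iff_of_nonneg (by positivity)).1 h1).le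
  obtain ⟨v, -, hdisj, hcov⟩ := Vitali.exists_disjoint_subfamily_covering_enlargement_closedBall
    (Set.univ : Set S) (fun x => (x : EuclideanSpace ℝ (Fin 2))) r _ hrb 4 (by norm_num)
  have hcount : v.Countable := hdisj.countable_of_nonempty_interior fun x _ => by
    refine ⟨x, ?_⟩
    exact Metric.ball_subset_interior_closedBall (Metric.mem_ball_self (hr0 x))
  have hsub : S ⊆ ⋃ x ∈ v, Metric.closedBall (x : EuclideanSpace ℝ (Fin 2)) (4 * r x) := by
    intro x hx
    obtain ⟨b, hb, hb2⟩ := hcov ⟨x, hx⟩ (Set.mem_univ _)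
    exact Set.mem_biUnion hb (hb2 (Metric.mem_closedBall_self (hr0 _).le))
  calc volume S ≤ volume (⋃ x ∈ v, Metric.closedBall (x : EuclideanSpace ℝ (Fin 2)) (4 * r x)) :=
        measure_mono hsub
    _ ≤ ∑' x : v, volume (Metric.closedBall ((x : S) : EuclideanSpace ℝ (Fin 2)) (4 * r x)) :=
        measure_biUnion_le _ hcount _
    _ ≤ ∑' x : v, ENNReal.ofReal 64 *
          ∫⁻ y in Metric.closedBall ((x : S) : EuclideanSpace ℝ (Fin 2)) (r x), e y := by
        refine ENNReal.tsum_le_tsum fun x => ?_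
        have h0 := hr0 x
        rw [EuclideanSpace.volume_closedBall_fin_two, ← ENNReal.ofReal_pow (by positivity),
          ← ENNReal.ofReal_mul (by positivity)]
        refine le_trans ?_ (mul_le_mul_right (hr x).le _)
        rw [← ENNReal.ofReal_mul (by positivity)]
        refine ENNReal.ofReal_le_ofReal ?_
        nlinarith [Real.pi_le_four, pow_pos h0 2]
    _ = ENNReal.ofReal 64 *
          ∫⁻ y in ⋃ x ∈ v, Metric.closedBall (x : EuclideanSpace ℝ (Fin 2)) (r x), e y := by
        rw [ENNReal.tsum_mul_left, lintegral_biUnion hcount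
          (fun _ _ => Metric.isClosed_closedBall.measurableSet) hdisj]
    _ ≤ ENNReal.ofReal 64 * ENNReal.ofReal I := by
        gcongr
        exact (setLIntegral_le_lintegral _ _).trans hI
    _ = ENNReal.ofReal (64 * I) := (ENNReal.ofReal_mul (by norm_num)).symm

/-- The determinant of `M • 1 - E` for a symmetric planar matrix `E`. -/
noncomputable def shiftedDet (M : ℝ) (E : Matrix (Fin 2) (Fin 2) ℝ) : ℝ :=
  (M - E 0 0) * (M - E 1 1) - E 0 1 ^ 2

theorem shiftedDet_symGradE_le_abs_det (M : ℝ)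
    (u : EuclideanSpace ℝ (Fin 2) → EuclideanSpace ℝ (Fin 2)) (x : EuclideanSpace ℝ (Fin 2)) :
    shiftedDet M (symGradE u x) ≤
      |(M • ContinuousLinearMap.id ℝ (EuclideanSpace ℝ (Fin 2)) - fderiv ℝ u x).det| := by
  refine le_trans ?_ (le_abs_self _)
  rw [ContinuousLinearMap.det, ← LinearMap.det_toMatrix (EuclideanSpace.basisFun (Fin 2) ℝ).toBasis,
    Matrix.det_fin_two]
  simp only [LinearMap.toMatrix_apply, shiftedDet, symGradE]
  simp
  nlinarith [sq_nonneg ((fderiv ℝ u x (EuclideanSpace.single 1 1)) 0 -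
    (fderiv ℝ u x (EuclideanSpace.single 0 1)) 1)]

theorem shiftedDet_sub_le (M : ℝ) (A E : Matrix (Fin 2) (Fin 2) ℝ) {ε : ℝ} (hε1 : ε ≤ 1)
    (h : frob (E - A) ≤ ε) :
    shiftedDet M A - (|M - A 0 0| + |M - A 1 1| + 2 * |A 0 1| + 2) * ε ≤ shiftedDet M E := by
  have h0 : 0 ≤ ε := (frob_nonneg _).trans h
  have key (p r s α β γ : ℝ) (hα : |α| ≤ ε) (hβ : |β| ≤ ε) (hγ : |γ| ≤ ε) :
      p * r - s ^ 2 - (|p| + |r| + 2 * |s| + 2) * ε ≤ (p - α) * (r - β) - (s + γ) ^ 2 := by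
    have h1 : |p * β| ≤ |p| * ε := by rw [abs_mul]; gcongr
    have h2 : |r * α| ≤ |r| * ε := by rw [abs_mul]; gcongr
    have h3 : |s * γ| ≤ |s| * ε := by rw [abs_mul]; gcongr
    have h4 : |α * β| ≤ ε * ε := by rw [abs_mul]; gcongr
    have h5 : |γ * γ| ≤ ε * ε := by rw [abs_mul]; gcongr
    rw [abs_le] at h1 h2 h3 h4 h5
    nlinarith [h1.1, h1.2, h2.1, h2.2, h3.1, h3.2, h4.1, h5.2]
  have := key (M - A 0 0) (M - A 1 1) (A 0 1) _ _ _ ((abs_apply_le_frob (E - A) 0 0).trans h)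
    ((abs_apply_le_frob (E - A) 1 1).trans h) ((abs_apply_le_frob (E - A) 0 1).trans h)
  simp only [shiftedDet]
  refine this.trans (le_of_eq ?_)
  simp only [Matrix.sub_apply]
  ring

theorem setLIntegral_shiftedDet_le {K : NNReal}
    {u : EuclideanSpace ℝ (Fin 2) → EuclideanSpace ℝ (Fin 2)} (hu : LipschitzWith K u)
    (hzero : ∀ x, 1 ≤ ‖x‖ → u x = 0) {Λ M : ℝ} (hΛ : 0 ≤ Λ) (hM : 23 * Λ < M)
    {s : Set (EuclideanSpace ℝ (Fin 2))} (hs : MeasurableSet s) (hs2 : s ⊆ Metric.ball 0 2)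
    (hdiff : ∀ x ∈ s, DifferentiableAt ℝ u x)
    (hgood : ∀ x ∈ s, ∀ r > 0, ∫⁻ z in Metric.ball x r, ENNReal.ofReal (frob (symGradE u z)) ≤
      ENNReal.ofReal (Λ * r ^ 2))
    (hfar : ∀ x, 2 ≤ ‖x‖ → ∀ r > 0,
      ∫⁻ z in Metric.ball x r, ENNReal.ofReal (frob (symGradE u z)) ≤
      ENNReal.ofReal (Λ * r ^ 2)) :
    ∫⁻ x in s, ENNReal.ofReal (shiftedDet M (symGradE u x)) ≤
      ENNReal.ofReal (4 * Real.pi * M ^ 2) := by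
  have hM0 : 0 < M := by linarith
  set v : EuclideanSpace ℝ (Fin 2) → EuclideanSpace ℝ (Fin 2) := fun x => M • x - u x with hv
  have hmono : ∀ x ∈ s, ∀ y, y ∈ s ∨ 2 ≤ ‖y‖ → x ≠ y → 0 < inner ℝ (v x - v y) (x - y) := by
    intro x hx y hy hxy
    have h1 := abs_inner_sub_le_of_average_le hu hΛ (hgood x hx)
      (hy.elim (hgood y) (hfar y))
    have h2 : v x - v y = M • (x - y) - (u x - u y) := by
      simp only [hv, smul_sub]; abel
    rw [h2, inner_sub_left, real_inner_smul_left, real_inner_self_eq_norm_sq]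
    have h3 : 0 < ‖x - y‖ ^ 2 := by
      have := norm_pos_iff.2 (sub_ne_zero.2 hxy)
      positivity
    nlinarith [le_abs_self (inner ℝ (u x - u y) (x - y))]
  have hinj : Set.InjOn v s := by
    intro x hx y hy hxy
    by_contra hne
    have := hmono x hx y (Or.inl hy) hne
    simp [hxy] at this
  have himage : v '' s ⊆ Metric.closedBall 0 (2 * M) := by
    rintro _ ⟨x, hx, rfl⟩
    rw [mem_closedBall_zero_iff]
    by_contra! hlt
    obtain ⟨w, hw⟩ : ∃ w, v x = M • w := ⟨M⁻¹ • v x, by rw [smul_inv_smul₀ hM0.ne']⟩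
    have hw2 : 2 < ‖w‖ := by
      rw [hw, norm_smul, Real.norm_eq_abs, abs_of_pos hM0] at hlt
      nlinarith
    have hx2 := mem_ball_zero_iff.1 (hs2 hx)
    have hsum : 0 < ‖x‖ + ‖w‖ := by linarith [norm_nonneg x]
    set t := (‖w‖ - 2) / (‖x‖ + ‖w‖) with ht
    have ht0 : 0 < t := div_pos (by linarith) hsum
    have ht1 : t < 1 := by rw [ht, div_lt_one hsum]; linarith [norm_nonneg x]
    set y := w + t • (x - w) with hy
    have hy2 : 2 ≤ ‖y‖ := by
      have h1 : ‖t • (x - w)‖ ≤ ‖w‖ - 2 := by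
        rw [norm_smul, Real.norm_eq_abs, abs_of_pos ht0]
        calc t * ‖x - w‖ ≤ t * (‖x‖ + ‖w‖) := by gcongr; exact norm_sub_le _ _
          _ = ‖w‖ - 2 := div_mul_cancel₀ _ hsum.ne'
      have h2 : ‖w‖ ≤ ‖y‖ + ‖t • (x - w)‖ := by
        have := norm_sub_le y (t • (x - w))
        rwa [hy, add_sub_cancel_right] at this
      linarith
    have hpos := hmono x hx y (Or.inr hy2) (by rintro h; rw [h] at hx2; linarith)
    have hvy : v y = M • y := by simp [hv, hzero y (by linarith)]
    have e1 : v x - v y = (-(M * t)) • (x - w) := by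
      rw [hw, hvy, hy, smul_add, sub_add_cancel_left, smul_smul, neg_smul]
    have e2 : x - y = (1 - t) • (x - w) := by
      rw [hy, sub_smul, one_smul]; abel
    rw [e1, e2, real_inner_smul_left, real_inner_smul_right, real_inner_self_eq_norm_sq] at hpos
    have : 0 ≤ M * t * ((1 - t) * ‖x - w‖ ^ 2) := by
      have : 0 ≤ 1 - t := by linarith
      positivity
    linarith
  have hderiv : ∀ x ∈ s, HasFDerivWithinAt v
      (M • ContinuousLinearMap.id ℝ (EuclideanSpace ℝ (Fin 2)) - fderiv ℝ u x) s x := fun x hx =>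
    (((hasFDerivAt_id x).const_smul M).sub (hdiff x hx).hasFDerivAt).hasFDerivWithinAt
  calc ∫⁻ x in s, ENNReal.ofReal (shiftedDet M (symGradE u x))
      ≤ ∫⁻ x in s, ENNReal.ofReal
          |(M • ContinuousLinearMap.id ℝ (EuclideanSpace ℝ (Fin 2)) - fderiv ℝ u x).det| :=
        lintegral_mono fun x => ENNReal.ofReal_le_ofReal (shiftedDet_symGradE_le_abs_det M u x)
    _ = volume (v '' s) := lintegral_abs_det_fderiv_eq_addHaar_image volume hs hderiv hinj
    _ ≤ volume (Metric.closedBall (0 : EuclideanSpace ℝ (Fin 2)) (2 * M)) := measure_mono himage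
    _ = ENNReal.ofReal (4 * Real.pi * M ^ 2) := by
        rw [EuclideanSpace.volume_closedBall_fin_two, ← ENNReal.ofReal_pow (by positivity),
          ← ENNReal.ofReal_mul (by positivity)]
        congr 1
        ring

theorem setLIntegral_frob_symGradE_le
    {u : EuclideanSpace ℝ (Fin 2) → EuclideanSpace ℝ (Fin 2)}
    {e : EuclideanSpace ℝ (Fin 2) → ENNReal} {κ : ℝ} (hκ : 0 ≤ κ)
    (he : ∀ᵐ x, ENNReal.ofReal (frob (symGradE u x)) ≤ ENNReal.ofReal κ + e x)
    {x : EuclideanSpace ℝ (Fin 2)} {r : ℝ} (hr : 0 < r)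
    (hx : ∫⁻ y in Metric.closedBall x r, e y ≤ ENNReal.ofReal (r ^ 2)) :
    ∫⁻ z in Metric.ball x r, ENNReal.ofReal (frob (symGradE u z)) ≤
      ENNReal.ofReal ((4 * κ + 1) * r ^ 2) := by
  calc ∫⁻ z in Metric.ball x r, ENNReal.ofReal (frob (symGradE u z))
      ≤ ∫⁻ z in Metric.ball x r, (ENNReal.ofReal κ + e z) :=
        lintegral_mono_ae (ae_restrict_of_ae he)
    _ = ENNReal.ofReal κ * volume (Metric.ball x r) + ∫⁻ z in Metric.ball x r, e z := by
        rw [lintegral_add_left measurable_const, setLIntegral_const]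
    _ ≤ ENNReal.ofReal (κ * (4 * r ^ 2)) + ENNReal.ofReal (r ^ 2) := by
        rw [EuclideanSpace.volume_ball_fin_two, ← ENNReal.ofReal_pow hr.le,
          ← ENNReal.ofReal_mul (by positivity), ← ENNReal.ofReal_mul hκ]
        gcongr ENNReal.ofReal ?_ + ?_
        · refine mul_le_mul_of_nonneg_left ?_ hκ
          nlinarith [Real.pi_le_four, pow_pos hr 2]
        · exact (lintegral_mono_set Metric.ball_subset_closedBall).trans hx
    _ = ENNReal.ofReal ((4 * κ + 1) * r ^ 2) := by
        rw [← ENNReal.ofReal_add (by positivity) (by positivity)]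
        congr 1
        ring

/-- The distance of the symmetrized gradient to the two states `A` and `B`. -/
noncomputable def wellDist (A B : Matrix (Fin 2) (Fin 2) ℝ)
    (u : EuclideanSpace ℝ (Fin 2) → EuclideanSpace ℝ (Fin 2)) (x : EuclideanSpace ℝ (Fin 2)) : ℝ :=
  min (frob (symGradE u x - A)) (frob (symGradE u x - B))

/-- The part of the unit ball where the symmetrized gradient is closer to `A` than to `B`. -/
def closerSet (A B : Matrix (Fin 2) (Fin 2) ℝ)
    (u : EuclideanSpace ℝ (Fin 2) → EuclideanSpace ℝ (Fin 2)) : Set (EuclideanSpace ℝ (Fin 2)) :=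
  Metric.ball 0 1 ∩ {x | frob (symGradE u x - A) ≤ frob (symGradE u x - B)}

theorem wellDist_nonneg (A B : Matrix (Fin 2) (Fin 2) ℝ)
    (u : EuclideanSpace ℝ (Fin 2) → EuclideanSpace ℝ (Fin 2)) (x : EuclideanSpace ℝ (Fin 2)) :
    0 ≤ wellDist A B u x :=
  le_min (frob_nonneg _) (frob_nonneg _)

theorem measurable_wellDist (A B : Matrix (Fin 2) (Fin 2) ℝ)
    (u : EuclideanSpace ℝ (Fin 2) → EuclideanSpace ℝ (Fin 2)) : Measurable (wellDist A B u) :=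
  (measurable_frob_symGradE_sub u A).min (measurable_frob_symGradE_sub u B)

theorem measurableSet_closerSet (A B : Matrix (Fin 2) (Fin 2) ℝ)
    (u : EuclideanSpace ℝ (Fin 2) → EuclideanSpace ℝ (Fin 2)) :
    MeasurableSet (closerSet A B u) :=
  Metric.isOpen_ball.measurableSet.inter
    (measurableSet_le (measurable_frob_symGradE_sub u A) (measurable_frob_symGradE_sub u B))

theorem exists_frob_symGradE_sub_le {d : ℕ} {K : NNReal}
    {u : EuclideanSpace ℝ (Fin d) → EuclideanSpace ℝ (Fin d)} (hu : LipschitzWith K u)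
    (A : Matrix (Fin d) (Fin d) ℝ) : ∃ C, ∀ x, frob (symGradE u x - A) ≤ C := by
  refine ⟨Real.sqrt (∑ i, ∑ j, (K + |A i j|) ^ 2), fun x => Real.sqrt_le_sqrt ?_⟩
  refine Finset.sum_le_sum fun i _ => Finset.sum_le_sum fun j _ => sq_le_sq' ?_ ?_ <;>
  · have h1 (i j : Fin d) : |(fderiv ℝ u x (EuclideanSpace.single j 1)) i| ≤ K := by
      have h2 := PiLp.norm_apply_le (fderiv ℝ u x (EuclideanSpace.single j 1)) i
      have h3 := (fderiv ℝ u x).le_opNorm (EuclideanSpace.single j 1)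
      have h4 := norm_fderiv_le_of_lipschitz ℝ hu (x₀ := x)
      rw [PiLp.norm_single, norm_one, mul_one] at h3
      exact h2.trans (h3.trans h4)
    have h2 := abs_le.1 (h1 i j)
    have h3 := abs_le.1 (h1 j i)
    simp only [Matrix.sub_apply, symGradE]
    linarith [le_abs_self (A i j), neg_abs_le (A i j), h2.1, h2.2, h3.1, h3.2]

theorem volume_unitBall : volume (Metric.ball (0 : EuclideanSpace ℝ (Fin 2)) 1) =
    ENNReal.ofReal Real.pi := by
  simp [EuclideanSpace.volume_ball_fin_two]

theorem measureReal_sub_le_diff {α : Type*} [MeasurableSpace α] {μ : Measure α} {s N : Set α}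
    {η : ℝ} (hη : 0 ≤ η) (hN : μ (N ∩ s) ≤ ENNReal.ofReal η) :
    μ.real s - η ≤ μ.real (s \ N) := by
  have h1 : μ.real s ≤ μ.real (s \ N) + μ.real (N ∩ s) := by
    rw [Set.inter_comm, add_comm]
    have := measureReal_union_le (μ := μ) (s ∩ N) (s \ N)
    rwa [Set.inter_union_sdiff] at this
  have h2 : μ.real (N ∩ s) ≤ η := ENNReal.toReal_le_of_le_ofReal hη hN
  linarith

/-- The area of the image of the good set of `M • id - u`, which is injective there, is at most
the area of the disc of radius `2 * M`. This bounds the determinants of `M • 1 - A` and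
`M • 1 - B` in terms of the volume fractions of the two states. -/
theorem exists_shiftedDet_volume_le (A B : Matrix (Fin 2) (Fin 2) ℝ) :
    ∃ M C : ℝ, ∀ ε, 0 < ε → ε ≤ 1 → ∀ (K : NNReal)
      (u : EuclideanSpace ℝ (Fin 2) → EuclideanSpace ℝ (Fin 2)), LipschitzWith K u →
      (∀ x, 1 ≤ ‖x‖ → u x = 0) →
      (∫⁻ x in Metric.ball 0 1, ENNReal.ofReal (wellDist A B u x) ≤ ENNReal.ofReal (ε ^ 2)) →
      volume.real (closerSet A B u) * shiftedDet M A +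
        (Real.pi - volume.real (closerSet A B u)) * shiftedDet M B ≤ Real.pi * M ^ 2 + C * ε := by
  set κ := frob A + frob B with hκ
  have hκ0 : 0 ≤ κ := add_nonneg (frob_nonneg _) (frob_nonneg _)
  set Λ := 4 * κ + 1 with hΛ
  set M := 23 * Λ + 1 with hM
  set CA := |M - A 0 0| + |M - A 1 1| + 2 * |A 0 1| + 2 with hCA
  set CB := |M - B 0 0| + |M - B 1 1| + 2 * |B 0 1| + 2 with hCB
  have hCA0 : 0 ≤ CA := by positivity
  have hCB0 : 0 ≤ CB := by positivity
  refine ⟨M, Real.pi * (CA + CB) + 65 * ((|shiftedDet M A| + CA) + (|shiftedDet M B| + CB)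
    + M ^ 2), fun ε hε hε1 K u hu hzero hd => ?_⟩
  set U := Metric.ball (0 : EuclideanSpace ℝ (Fin 2)) 1 with hU
  have hUm : MeasurableSet U := Metric.isOpen_ball.measurableSet
  set e : EuclideanSpace ℝ (Fin 2) → ENNReal :=
    U.indicator fun x => ENNReal.ofReal (wellDist A B u x) with he
  have hem : Measurable e := ((measurable_wellDist A B u).ennreal_ofReal).indicator hUm
  have heI : ∫⁻ x, e x ≤ ENNReal.ofReal (ε ^ 2) := by rwa [lintegral_indicator hUm]
  have hFe : ∀ᵐ x, ENNReal.ofReal (frob (symGradE u x)) ≤ ENNReal.ofReal κ + e x := by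
    have h0 : ∀ᵐ x : EuclideanSpace ℝ (Fin 2), x ∉ Metric.sphere 0 1 :=
      measure_eq_zero_iff_ae_notMem.1 (Measure.addHaar_sphere _ _ _)
    filter_upwards [h0] with x hx
    rw [mem_sphere_zero_iff_norm] at hx
    rcases lt_or_gt_of_ne hx with hx | hx
    · rw [he, Set.indicator_of_mem (mem_ball_zero_iff.2 hx),
        ← ENNReal.ofReal_add hκ0 (wellDist_nonneg _ _ _ _)]
      refine ENNReal.ofReal_le_ofReal ?_
      have h1 := frob_le_sub_add (symGradE u x) A
      have h2 := frob_le_sub_add (symGradE u x) B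
      have h3 := frob_nonneg A
      have h4 := frob_nonneg B
      rcases min_choice (frob (symGradE u x - A)) (frob (symGradE u x - B)) with h | h <;>
      · rw [wellDist, h]
        linarith
    · rw [symGradE_eq_zero hzero hx]
      simp [frob]
  set bad : Set (EuclideanSpace ℝ (Fin 2)) :=
    {x | ∃ r > 0, ENNReal.ofReal (r ^ 2) < ∫⁻ y in Metric.closedBall x r, e y} with hbad
  have hbadv : volume bad ≤ ENNReal.ofReal (64 * ε ^ 2) :=
    volume_exists_lt_setLIntegral_closedBall_le e heI
  have hgood : ∀ x, x ∉ bad → ∀ r > 0,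
      ∫⁻ z in Metric.ball x r, ENNReal.ofReal (frob (symGradE u z)) ≤
        ENNReal.ofReal (Λ * r ^ 2) := by
    intro x hx r hr
    refine setLIntegral_frob_symGradE_le hκ0 hFe hr ?_
    by_contra! hlt
    exact hx ⟨r, hr, hlt⟩
  have hfar : ∀ x, 2 ≤ ‖x‖ → x ∉ bad := by
    rintro x hx ⟨r, hr, hlt⟩
    rcases lt_or_ge r 1 with hr1 | hr1
    · have h0 : ∫⁻ y in Metric.closedBall x r, e y = 0 := by
        rw [setLIntegral_congr_fun Metric.isClosed_closedBall.measurableSet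
          (g := fun _ => 0) ?_, lintegral_zero]
        intro y hy
        refine Set.indicator_of_notMem (fun hyU => ?_) _
        have h1 := mem_ball_zero_iff.1 hyU
        rw [Metric.mem_closedBall, dist_comm, dist_eq_norm] at hy
        have h2 := norm_add_le (x - y) y
        rw [sub_add_cancel] at h2
        linarith
      rw [h0] at hlt
      exact not_lt_bot hlt
    · have h1 := hlt.trans_le ((setLIntegral_le_lintegral _ _).trans heI)
      rw [ENNReal.ofReal_lt_ofReal_iff_of_nonneg (by positivity)] at h1
      nlinarith
  set T : Set (EuclideanSpace ℝ (Fin 2)) := {x | ENNReal.ofReal ε ≤ e x} with hT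
  have hTv : volume T ≤ ENNReal.ofReal ε := by
    have h1 := (mul_meas_ge_le_lintegral hem (ENNReal.ofReal ε)).trans heI
    rw [pow_two, ENNReal.ofReal_mul hε.le] at h1
    exact (ENNReal.mul_le_mul_iff_right (by simpa using hε) ENNReal.ofReal_ne_top).1 h1
  set D : Set (EuclideanSpace ℝ (Fin 2)) := {x | DifferentiableAt ℝ u x} with hD
  have hDv : volume Dᶜ = 0 := hu.ae_differentiableAt
  have hDm : MeasurableSet D := measurableSet_of_differentiableAt ℝ u
  set N := toMeasurable volume bad ∪ T ∪ Dᶜ with hN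
  have hNm : MeasurableSet N :=
    ((measurableSet_toMeasurable _ _).union (measurableSet_le measurable_const hem)).union
      hDm.compl
  have hNv : volume N ≤ ENNReal.ofReal (65 * ε) := by
    calc volume N ≤ volume (toMeasurable volume bad) + volume T + volume Dᶜ :=
          (measure_union_le _ _).trans (by gcongr; exact measure_union_le _ _)
      _ ≤ ENNReal.ofReal (64 * ε ^ 2) + ENNReal.ofReal ε + 0 := by
          rw [measure_toMeasurable, hDv]
          gcongr
      _ ≤ ENNReal.ofReal (65 * ε) := by
          rw [add_zero, ← ENNReal.ofReal_add (by positivity) hε.le]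
          refine ENNReal.ofReal_le_ofReal ?_
          nlinarith
  set SA := closerSet A B u with hSA
  have hSAm : MeasurableSet SA := measurableSet_closerSet A B u
  have hSAU : SA ⊆ U := Set.inter_subset_left
  set R := Metric.ball (0 : EuclideanSpace ℝ (Fin 2)) 2 \ Metric.closedBall 0 1 with hR
  have hRm : MeasurableSet R :=
    Metric.isOpen_ball.measurableSet.diff Metric.isClosed_closedBall.measurableSet
  have hUfin : volume U ≠ ⊤ := by rw [volume_unitBall]; exact ENNReal.ofReal_ne_top
  have hUreal : volume.real U = Real.pi := by
    rw [measureReal_def, volume_unitBall, ENNReal.toReal_ofReal Real.pi_pos.le]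
  have h2ball : volume (Metric.ball (0 : EuclideanSpace ℝ (Fin 2)) 2) =
      ENNReal.ofReal (4 * Real.pi) := by
    rw [EuclideanSpace.volume_ball_fin_two, ← ENNReal.ofReal_pow (by positivity),
      ← ENNReal.ofReal_mul (by positivity)]
    norm_num
  have hUB : U ⊆ Metric.ball 0 2 := Metric.ball_subset_ball (by norm_num)
  have hRreal : volume.real R = 3 * Real.pi := by
    rw [hR, measureReal_sdiff (Metric.closedBall_subset_ball (by norm_num))
      Metric.isClosed_closedBall.measurableSet (h2ball ▸ ENNReal.ofReal_ne_top),
      measureReal_def, measureReal_def, Measure.addHaar_closedBall_eq_addHaar_ball,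
      volume_unitBall, h2ball, ENNReal.toReal_ofReal (by positivity),
      ENNReal.toReal_ofReal (by positivity)]
    ring
  have hRfin : volume R ≠ ⊤ :=
    ((measure_mono Set.sdiff_subset).trans_lt (h2ball ▸ ENNReal.ofReal_lt_top)).ne
  have hSAfin : volume SA ≠ ⊤ := ((measure_mono hSAU).trans_lt hUfin.lt_top).ne
  have hSBfin : volume (U \ SA) ≠ ⊤ :=
    ((measure_mono Set.sdiff_subset).trans_lt hUfin.lt_top).ne
  have hSBreal : volume.real (U \ SA) = Real.pi - volume.real SA := by
    rw [measureReal_sdiff hSAU hSAm hUfin, hUreal]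
  set a := volume.real SA with ha
  have hvol : ∀ S, volume S ≠ ⊤ → ∀ c : ℝ,
      c * volume.real S - |c| * (65 * ε) ≤ c * volume.real (S \ N) := by
    intro S hS c
    have h1 := measureReal_sub_le_diff (by positivity)
      ((measure_mono (Set.inter_subset_left (t := S))).trans hNv)
    have h2 : volume.real (S \ N) ≤ volume.real S := measureReal_mono Set.sdiff_subset hS
    have h3 : |c * (volume.real (S \ N) - volume.real S)| ≤ |c| * (65 * ε) := by
      rw [abs_mul]
      gcongr
      rw [abs_le]
      constructor <;> linarith
    have := (abs_le.1 h3).1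
    linarith
  have hlow : ∀ S, MeasurableSet S → volume S ≠ ⊤ → ∀ c : ℝ,
      (∀ x ∈ S \ N, c ≤ shiftedDet M (symGradE u x)) →
      ENNReal.ofReal (c * volume.real (S \ N)) ≤
        ∫⁻ x in S \ N, ENNReal.ofReal (shiftedDet M (symGradE u x)) := by
    intro S hSm hS c hc
    rw [ENNReal.ofReal_mul' measureReal_nonneg, ofReal_measureReal
      ((measure_mono Set.sdiff_subset).trans_lt hS.lt_top).ne, ← setLIntegral_const]
    exact lintegral_mono_ae ((ae_restrict_mem (hSm.diff hNm)).mono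
      fun x hx => ENNReal.ofReal_le_ofReal (hc x hx))
  have hdist : ∀ x ∈ U, x ∉ N → wellDist A B u x ≤ ε := by
    intro x hxU hxN
    by_contra! hlt
    refine hxN (Or.inl (Or.inr ?_))
    change ENNReal.ofReal ε ≤ e x
    rw [he, Set.indicator_of_mem hxU]
    exact ENNReal.ofReal_le_ofReal hlt.le
  have hA := hlow SA hSAm hSAfin (shiftedDet M A - CA * ε) fun x hx => by
    refine shiftedDet_sub_le M A _ hε1 ?_
    have h1 := hdist x (hSAU hx.1) hx.2
    rwa [wellDist, min_eq_left hx.1.2] at h1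
  have hB := hlow (U \ SA) (hUm.diff hSAm) hSBfin (shiftedDet M B - CB * ε) fun x hx => by
    refine shiftedDet_sub_le M B _ hε1 ?_
    have h1 := hdist x hx.1.1 hx.2
    have h2 : ¬ frob (symGradE u x - A) ≤ frob (symGradE u x - B) :=
      fun h => hx.1.2 ⟨hx.1.1, h⟩
    rwa [wellDist, min_eq_right (le_of_not_ge h2)] at h1
  have hC := hlow R hRm hRfin (M ^ 2) fun x hx => by
    have h1 : 1 < ‖x‖ := by simpa using hx.1.2
    rw [symGradE_eq_zero hzero h1]
    simp [shiftedDet, pow_two]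
  have hsum := setLIntegral_shiftedDet_le hu hzero (M := M) (Λ := Λ) (by positivity)
    (by linarith) (s := SA \ N ∪ (U \ SA) \ N ∪ R \ N)
    (((hSAm.diff hNm).union ((hUm.diff hSAm).diff hNm)).union (hRm.diff hNm)) ?_ ?_ ?_
    fun x hx => hgood x (hfar x hx)
  · rw [lintegral_union (hRm.diff hNm) ?_, lintegral_union ((hUm.diff hSAm).diff hNm) ?_] at hsum
    · have h1 := ENNReal.ofReal_add_le.trans
        ((add_le_add (ENNReal.ofReal_add_le.trans (add_le_add hA hB)) hC).trans hsum)
      rw [ENNReal.ofReal_le_ofReal_iff (by positivity)] at h1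
      have h2 := hvol SA hSAfin (shiftedDet M A - CA * ε)
      have h3 := hvol (U \ SA) hSBfin (shiftedDet M B - CB * ε)
      have h4 := hvol R hRfin (M ^ 2)
      rw [hSBreal] at h3
      rw [hRreal, abs_of_nonneg (sq_nonneg M)] at h4
      have ha0 : 0 ≤ a := measureReal_nonneg
      have haπ : a ≤ Real.pi := hUreal ▸ measureReal_mono hSAU hUfin
      have habs (q c : ℝ) (hc : 0 ≤ c) : |q - c * ε| ≤ |q| + c := by
        have h5 := abs_sub q (c * ε)
        rw [abs_of_nonneg (mul_nonneg hc hε.le)] at h5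
        nlinarith
      have h5 := mul_le_mul_of_nonneg_right (habs (shiftedDet M A) CA hCA0)
        (by positivity : 0 ≤ 65 * ε)
      have h6 := mul_le_mul_of_nonneg_right (habs (shiftedDet M B) CB hCB0)
        (by positivity : 0 ≤ 65 * ε)
      have h7 := mul_le_mul_of_nonneg_right haπ (by positivity : 0 ≤ CA * ε)
      have h8 := mul_le_mul_of_nonneg_right (sub_le_self Real.pi ha0)
        (by positivity : 0 ≤ CB * ε)
      linarith
    · exact Set.disjoint_left.2 fun x hx hx' => hx'.1.2 hx.1
    · refine Set.disjoint_left.2 fun x hx hx' => hx'.1.2 (Metric.ball_subset_closedBall ?_)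
      exact hx.elim (fun h => hSAU h.1) fun h => h.1.1
  · rintro x ((hx | hx) | hx)
    exacts [hUB (hSAU hx.1), hUB hx.1.1, hx.1.1]
  · intro x hx
    by_contra h
    have hxN : x ∉ N := by
      rcases hx with (hx | hx) | hx <;> exact hx.2
    exact hxN (Or.inr h)
  · intro x hx
    have hxN : x ∉ N := by
      rcases hx with (hx | hx) | hx <;> exact hx.2
    exact hgood x fun h => hxN (Or.inl (Or.inl (subset_toMeasurable _ _ h)))

theorem integrableOn_of_measurable_of_bound {α : Type*} [MeasurableSpace α] {μ : Measure α}
    {s : Set α} (hs : μ s ≠ ⊤) {f : α → ℝ} (hf : Measurable f) (h0 : ∀ x, 0 ≤ f x)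
    (hC : ∃ C, ∀ x, f x ≤ C) : IntegrableOn f s μ := by
  obtain ⟨C, hC⟩ := hC
  exact IntegrableOn.of_bound hs.lt_top hf.aestronglyMeasurable C
    (.of_forall fun x => by rw [Real.norm_of_nonneg (h0 x)]; exact hC x)

theorem integrableOn_rpow_of_measurable_of_bound {α : Type*} [MeasurableSpace α] {μ : Measure α}
    {s : Set α} (hs : μ s ≠ ⊤) {p : ℝ} (hp : 1 ≤ p) {f : α → ℝ} (hf : Measurable f)
    (h0 : ∀ x, 0 ≤ f x) (hC : ∃ C, ∀ x, f x ≤ C) : IntegrableOn (fun x => f x ^ p) s μ := by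
  obtain ⟨C, hC⟩ := hC
  exact integrableOn_of_measurable_of_bound hs (hf.pow_const p)
    (fun x => Real.rpow_nonneg (h0 x) p)
    ⟨C ^ p, fun x => Real.rpow_le_rpow (h0 x) (hC x) (by linarith)⟩

theorem tendsto_setIntegral_of_tendsto_setIntegral_rpow {α : Type*} [MeasurableSpace α]
    {μ : Measure α} {s : Set α} (hs : μ s ≠ ⊤) {p : ℝ} (hp : 1 ≤ p) {f : ℕ → α → ℝ}
    (hf : ∀ n, Measurable (f n)) (h0 : ∀ n x, 0 ≤ f n x) (hC : ∀ n, ∃ C, ∀ x, f n x ≤ C)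
    (hlim : Tendsto (fun n => ∫ x in s, f n x ^ p ∂μ) atTop (nhds 0)) :
    Tendsto (fun n => ∫ x in s, f n x ∂μ) atTop (nhds 0) := by
  have hbound (τ : ℝ) (hτ : 0 < τ) (n : ℕ) :
      ∫ x in s, f n x ∂μ ≤ μ.real s * τ + τ ^ (1 - p) * ∫ x in s, f n x ^ p ∂μ := by
    have hi := integrableOn_rpow_of_measurable_of_bound hs hp (hf n) (h0 n) (hC n)
    have hc : IntegrableOn (fun _ => τ) s μ := integrableOn_const hs
    rw [← integral_const_mul, ← smul_eq_mul (μ.real s), ← setIntegral_const,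
      ← integral_add hc (hi.const_mul _)]
    refine integral_mono (integrableOn_of_measurable_of_bound hs (hf n) (h0 n) (hC n))
      (hc.add (hi.const_mul _)) fun x => ?_
    change f n x ≤ τ + τ ^ (1 - p) * f n x ^ p
    have h1 : 0 ≤ f n x ^ p := Real.rpow_nonneg (h0 n x) p
    rcases le_or_gt (f n x) τ with h | h
    · exact h.trans (le_add_of_nonneg_right (by positivity))
    · have h2 : f n x = f n x ^ (1 - p) * f n x ^ p := by
        rw [← Real.rpow_add (hτ.trans h), sub_add_cancel, Real.rpow_one]
      have h3 := Real.rpow_le_rpow_of_nonpos hτ h.le (by linarith : 1 - p ≤ 0)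
      have h4 := mul_le_mul_of_nonneg_right h3 h1
      linarith
  refine tendsto_order.2 ⟨fun b hb => .of_forall fun n =>
    hb.trans_le (integral_nonneg (h0 n)), fun δ hδ => ?_⟩
  set τ := δ / (2 * (μ.real s + 1)) with hτ
  have hm : 0 ≤ μ.real s := measureReal_nonneg
  have hτ0 : 0 < τ := by positivity
  have h1 : μ.real s * τ ≤ δ / 2 := by
    have : (μ.real s + 1) * τ = δ / 2 := by rw [hτ]; field_simp
    nlinarith
  have h2 := hlim.const_mul (τ ^ (1 - p))
  rw [mul_zero] at h2
  filter_upwards [h2.eventually_lt_const (half_pos hδ)] with n hn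
  linarith [hbound τ hτ0 n]

theorem setIntegral_rpow_le_of_le_add {α : Type*} [MeasurableSpace α]
    {μ : Measure α} {s S : Set α} (hs : μ s ≠ ⊤) (hS : MeasurableSet S) (hSs : S ⊆ s)
    (hsm : MeasurableSet s) {p : ℝ} (hp : 1 ≤ p) {f g : α → ℝ} {D : ℝ} (hD : 0 ≤ D)
    (hf : Measurable f) (hf0 : ∀ x, 0 ≤ f x) (hfC : ∃ C, ∀ x, f x ≤ C)
    (hg : Measurable g) (hg0 : ∀ x, 0 ≤ g x) (hgC : ∃ C, ∀ x, g x ≤ C)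
    (hle : ∀ x, g x ≤ f x + D) (hle' : ∀ x ∈ s, x ∉ S → g x ≤ f x) :
    ∫ x in s, g x ^ p ∂μ ≤ 2 ^ p * ∫ x in s, f x ^ p ∂μ + (2 * D) ^ p * μ.real S := by
  have hp0 : 0 ≤ p := by linarith
  have hi := integrableOn_rpow_of_measurable_of_bound hs hp hf hf0 hfC
  have hc : IntegrableOn (S.indicator fun _ => (2 * D) ^ p) s μ :=
    (integrableOn_const hs).indicator hS
  have h1 : ∫ x in s, S.indicator (fun _ => (2 * D) ^ p) x ∂μ = (2 * D) ^ p * μ.real S := by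
    rw [setIntegral_indicator hS, Set.inter_eq_right.2 hSs, setIntegral_const, smul_eq_mul,
      mul_comm]
  rw [← h1, ← integral_const_mul, ← integral_add (hi.const_mul _) hc]
  refine setIntegral_mono_on (integrableOn_rpow_of_measurable_of_bound hs hp hg hg0 hgC)
    ((hi.const_mul _).add hc) hsm fun x hx => ?_
  have h2 : 0 ≤ f x ^ p := Real.rpow_nonneg (hf0 x) p
  have h3 : (1 : ℝ) ≤ 2 ^ p := Real.one_le_rpow one_le_two hp0
  change g x ^ p ≤ 2 ^ p * f x ^ p + _
  by_cases hxS : x ∈ S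
  · rw [Set.indicator_of_mem hxS, ← Real.mul_rpow zero_le_two (hf0 x)]
    have h4 : 0 ≤ (2 * f x) ^ p := Real.rpow_nonneg (by linarith [hf0 x]) p
    have h5 : 0 ≤ (2 * D) ^ p := Real.rpow_nonneg (by linarith) p
    rcases le_total (f x) D with h | h
    · have := Real.rpow_le_rpow (hg0 x) (show g x ≤ 2 * D by linarith [hle x]) hp0
      linarith
    · have := Real.rpow_le_rpow (hg0 x) (show g x ≤ 2 * f x by linarith [hle x]) hp0
      linarith
  · rw [Set.indicator_of_notMem hxS, add_zero]
    have := Real.rpow_le_rpow (hg0 x) (hle' x hx hxS) hp0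
    nlinarith

theorem lineDeriv_euclidean_apply {d : ℕ} {u : EuclideanSpace ℝ (Fin d) → EuclideanSpace ℝ (Fin d)}
    {x : EuclideanSpace ℝ (Fin d)} (hx : DifferentiableAt ℝ u x) (i : Fin d)
    (v : EuclideanSpace ℝ (Fin d)) : lineDeriv ℝ (fun y => u y i) x v = fderiv ℝ u x v i := by
  have h := ((EuclideanSpace.proj i : EuclideanSpace ℝ (Fin d) →L[ℝ] ℝ).hasFDerivAt).comp x
    hx.hasFDerivAt
  exact h.hasLineDerivAt v |>.lineDeriv

/-- The symmetrized gradient of a Lipschitz map supported in the unit ball has zero mean. -/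
theorem setIntegral_symGradE_apply_eq_zero {K : NNReal}
    {u : EuclideanSpace ℝ (Fin 2) → EuclideanSpace ℝ (Fin 2)} (hu : LipschitzWith K u)
    (hzero : ∀ x, 1 ≤ ‖x‖ → u x = 0) (i j : Fin 2) :
    IntegrableOn (fun x => symGradE u x i j) (Metric.ball 0 1) ∧
      ∫ x in Metric.ball (0 : EuclideanSpace ℝ (Fin 2)) 1, symGradE u x i j = 0 := by
  have hfin : volume (Metric.ball (0 : EuclideanSpace ℝ (Fin 2)) 1) ≠ ⊤ := by
    rw [volume_unitBall]; exact ENNReal.ofReal_ne_top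
  have : IsFiniteMeasure (volume.restrict (Metric.ball (0 : EuclideanSpace ℝ (Fin 2)) 1)) :=
    isFiniteMeasure_restrict.2 hfin
  have hsph : ∀ᵐ x : EuclideanSpace ℝ (Fin 2), x ∉ Metric.sphere 0 1 :=
    measure_eq_zero_iff_ae_notMem.1 (Measure.addHaar_sphere _ _ _)
  have hlip (i : Fin 2) : LipschitzWith K fun x => u x i :=
    LipschitzWith.of_dist_le_mul fun x y =>
      (PiLp.norm_apply_le (u x - u y) i).trans (by simpa [dist_eq_norm] using hu.dist_le_mul x y)
  have hint (i : Fin 2) (v : EuclideanSpace ℝ (Fin 2)) :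
      IntegrableOn (fun x => lineDeriv ℝ (fun y => u y i) x v) (Metric.ball 0 1) :=
    ((hlip i).memLp_lineDeriv (μ := volume.restrict (Metric.ball 0 1)) v).integrable le_top
  have hmean (i : Fin 2) (v : EuclideanSpace ℝ (Fin 2)) :
      ∫ x in Metric.ball (0 : EuclideanSpace ℝ (Fin 2)) 1,
        lineDeriv ℝ (fun y => u y i) x v = 0 := by
    rw [setIntegral_eq_integral_of_ae_compl_eq_zero]
    · have hsupp : HasCompactSupport fun x => u x i :=
        HasCompactSupport.intro (isCompact_closedBall 0 1) fun x hx => by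
          have hx' : 1 < ‖x‖ := by simpa using hx
          simp [hzero x hx'.le]
      have h := (LipschitzWith.const (1 : ℝ)).integral_lineDeriv_mul_eq (μ := volume)
        (hlip i) hsupp (-v)
      rw [neg_neg] at h
      simpa [lineDeriv] using h.symm
    · filter_upwards [hsph] with x hx hxU
      have hx1 : 1 < ‖x‖ := by
        rw [mem_sphere_zero_iff_norm] at hx
        rw [mem_ball_zero_iff, not_lt] at hxU
        exact lt_of_le_of_ne hxU (Ne.symm hx)
      have h1 : (fun y => u y i) =ᶠ[nhds x] fun _ => 0 := by
        filter_upwards [(isOpen_lt continuous_const continuous_norm).mem_nhds hx1] with y hy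
        simp [hzero y (le_of_lt hy)]
      rw [h1.lineDeriv_eq]
      simp [lineDeriv]
  have hE : (fun x => symGradE u x i j) =ᵐ[volume.restrict (Metric.ball 0 1)] fun x =>
      (lineDeriv ℝ (fun y => u y i) x (EuclideanSpace.single j 1) +
        lineDeriv ℝ (fun y => u y j) x (EuclideanSpace.single i 1)) / 2 := by
    filter_upwards [ae_restrict_of_ae hu.ae_differentiableAt] with x hx
    rw [lineDeriv_euclidean_apply hx, lineDeriv_euclidean_apply hx, symGradE]
  constructor
  · exact (integrable_congr hE).2 (((hint _ _).add (hint _ _)).div_const 2)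
  · rw [integral_congr_ae hE, integral_div, integral_add (hint _ _) (hint _ _), hmean, hmean]
    simp

theorem abs_average_le_setIntegral_wellDist (A B : Matrix (Fin 2) (Fin 2) ℝ) {K : NNReal}
    {u : EuclideanSpace ℝ (Fin 2) → EuclideanSpace ℝ (Fin 2)} (hu : LipschitzWith K u)
    (hzero : ∀ x, 1 ≤ ‖x‖ → u x = 0) (i j : Fin 2) :
    |volume.real (closerSet A B u) * A i j + (Real.pi - volume.real (closerSet A B u)) * B i j| ≤
      ∫ x in Metric.ball 0 1, wellDist A B u x := by
  obtain ⟨hint, hmean⟩ := setIntegral_symGradE_apply_eq_zero hu hzero i j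
  set U := Metric.ball (0 : EuclideanSpace ℝ (Fin 2)) 1 with hU
  set S := closerSet A B u with hS
  have hUm : MeasurableSet U := Metric.isOpen_ball.measurableSet
  have hSm : MeasurableSet S := measurableSet_closerSet A B u
  have hSU : S ⊆ U := Set.inter_subset_left
  have hUfin : volume U ≠ ⊤ := by rw [volume_unitBall]; exact ENNReal.ofReal_ne_top
  have hUreal : volume.real U = Real.pi := by
    rw [measureReal_def, volume_unitBall, ENNReal.toReal_ofReal Real.pi_pos.le]
  have hd : IntegrableOn (wellDist A B u) U :=
    integrableOn_of_measurable_of_bound hUfin (measurable_wellDist A B u) (wellDist_nonneg A B u)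
      ((exists_frob_symGradE_sub_le hu A).imp fun C hC x => (min_le_left _ _).trans (hC x))
  have key (T : Set (EuclideanSpace ℝ (Fin 2))) (hT : MeasurableSet T) (hTU : T ⊆ U)
      (G : Matrix (Fin 2) (Fin 2) ℝ) (hG : ∀ x ∈ T, frob (symGradE u x - G) ≤ wellDist A B u x) :
      |(∫ x in T, symGradE u x i j) - volume.real T * G i j| ≤ ∫ x in T, wellDist A B u x := by
    have hTfin : volume T ≠ ⊤ := ((measure_mono hTU).trans_lt hUfin.lt_top).ne
    have hc : IntegrableOn (fun _ => G i j) T volume := integrableOn_const hTfin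
    rw [← smul_eq_mul (volume.real T), ← setIntegral_const, ← integral_sub (hint.mono_set hTU) hc]
    refine abs_integral_le_integral_abs.trans (setIntegral_mono_on
      ((hint.mono_set hTU).sub hc).abs (hd.mono_set hTU) hT fun x hx => ?_)
    exact (abs_apply_le_frob (symGradE u x - G) i j).trans (hG x hx)
  have h1 := key S hSm hSU A fun x hx => le_min le_rfl hx.2
  have h2 := key (U \ S) (hUm.diff hSm) Set.sdiff_subset B fun x hx =>
    le_min (le_of_not_ge fun h => hx.2 ⟨hx.1, h⟩) le_rfl
  rw [measureReal_sdiff hSU hSm hUfin, hUreal, setIntegral_sdiff hSm hint hSU, hmean,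
    setIntegral_sdiff hSm hd hSU] at h2
  rw [abs_le] at h1 h2 ⊢
  constructor <;> linarith [h1.1, h1.2, h2.1, h2.2]

theorem exists_eq_symTensor_of_det_nonpos {C : Matrix (Fin 2) (Fin 2) ℝ} (hC : C.IsSymm)
    (hdet : C 0 0 * C 1 1 - C 0 1 ^ 2 ≤ 0) : ∃ a b, C = symTensor a b := by
  have h10 : C 1 0 = C 0 1 := hC.apply 0 1
  by_cases h0 : C 0 0 = 0
  · refine ⟨![0, 1], ![2 * C 0 1, C 1 1], ?_⟩
    ext i j
    fin_cases i <;> fin_cases j <;> simp [symTensor, h0, h10]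
  · have hs := Real.sq_sqrt (show 0 ≤ C 0 1 ^ 2 - C 0 0 * C 1 1 by linarith)
    set s := Real.sqrt (C 0 1 ^ 2 - C 0 0 * C 1 1)
    refine ⟨![C 0 0, C 0 1 + s], ![1, (C 0 1 - s) / C 0 0], ?_⟩
    ext i j
    fin_cases i <;> fin_cases j <;> simp [symTensor, h10] <;> field_simp <;> nlinarith

/-- If a combination of `A` and `B` with positive weights vanishes and `det (B - A) > 0`, then
`A` and `B` violate the bound of `exists_shiftedDet_volume_le`. -/
theorem shiftedDet_add_lt {A B : Matrix (Fin 2) (Fin 2) ℝ} {a b M : ℝ} (ha : 0 < a)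
    (hb : 0 < b) (hmean : ∀ i j, a * A i j + b * B i j = 0)
    (hdet : 0 < (B 0 0 - A 0 0) * (B 1 1 - A 1 1) - (B 0 1 - A 0 1) ^ 2) :
    (a + b) * M ^ 2 < a * shiftedDet M A + b * shiftedDet M B := by
  have hB (i j) : B i j = -(a / b) * A i j := by
    have := hmean i j
    field_simp
    linarith
  set t := a / b with ht
  have ht0 : 0 < t := div_pos ha hb
  have hab : a = t * b := by rw [ht]; field_simp
  have h1 : 0 < (1 + t) ^ 2 * (A 0 0 * A 1 1 - A 0 1 ^ 2) := by
    rw [hB, hB, hB] at hdet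
    linarith
  have h2 : 0 < A 0 0 * A 1 1 - A 0 1 ^ 2 := pos_of_mul_pos_right h1 (by positivity)
  have h3 : 0 < b * t * (1 + t) * (A 0 0 * A 1 1 - A 0 1 ^ 2) := by positivity
  simp only [shiftedDet, hB, hab]
  linarith

theorem frob_sub_comm {d : ℕ} (M N : Matrix (Fin d) (Fin d) ℝ) : frob (M - N) = frob (N - M) := by
  simp only [frob, Matrix.sub_apply, sub_sq_comm]

/-- Two-state rigidity for symmetrized gradients: if `A, B` are symmetric `2×2` matrices
with `B − A ≠ a ⊙ b` for all `a, b`, and `(ψ_j)` are Lipschitz maps vanishing outside the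
unit ball with `∫_{B₁} dist(𝓔ψ_j, {A,B})^p → 0`, then along a subsequence either
`𝓔ψ_j → A` or `𝓔ψ_j → B` in `L^p(B₁)`. -/
theorem two_state_rigidity (p : ℝ) (hp : 1 ≤ p)
    (A B : Matrix (Fin 2) (Fin 2) ℝ) (hA : A.IsSymm) (hB : B.IsSymm)
    (hAB : ∀ a b : Fin 2 → ℝ, B - A ≠ symTensor a b)
    (ψ : ℕ → EuclideanSpace ℝ (Fin 2) → EuclideanSpace ℝ (Fin 2))
    (hlip : ∀ j, ∃ K, LipschitzWith K (ψ j))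
    (hzero : ∀ j x, 1 ≤ ‖x‖ → ψ j x = 0)
    (hconv : Tendsto (fun j => ∫ x in Metric.ball (0 : EuclideanSpace ℝ (Fin 2)) 1,
        (min (frob (symGradE (ψ j) x - A)) (frob (symGradE (ψ j) x - B))) ^ p)
      atTop (nhds 0)) :
    ∃ φ : ℕ → ℕ, StrictMono φ ∧
      (Tendsto (fun m => ∫ x in Metric.ball (0 : EuclideanSpace ℝ (Fin 2)) 1,
          (frob (symGradE (ψ (φ m)) x - A)) ^ p) atTop (nhds 0) ∨
       Tendsto (fun m => ∫ x in Metric.ball (0 : EuclideanSpace ℝ (Fin 2)) 1,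
          (frob (symGradE (ψ (φ m)) x - B)) ^ p) atTop (nhds 0)) := by
  choose K hK using hlip
  set U := Metric.ball (0 : EuclideanSpace ℝ (Fin 2)) 1 with hU
  have hUm : MeasurableSet U := Metric.isOpen_ball.measurableSet
  have hUfin : volume U ≠ ⊤ := by rw [volume_unitBall]; exact ENNReal.ofReal_ne_top
  have hUreal : volume.real U = Real.pi := by
    rw [measureReal_def, volume_unitBall, ENNReal.toReal_ofReal Real.pi_pos.le]
  have hdm (j) := measurable_wellDist A B (ψ j)
  have hd0 (j) := wellDist_nonneg A B (ψ j)
  have hdC (j) : ∃ C, ∀ x, wellDist A B (ψ j) x ≤ C :=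
    (exists_frob_symGradE_sub_le (hK j) A).imp fun C hC x => (min_le_left _ _).trans (hC x)
  have hconv' : Tendsto (fun j => ∫ x in U, wellDist A B (ψ j) x ^ p) atTop (nhds 0) := hconv
  have hL1 := tendsto_setIntegral_of_tendsto_setIntegral_rpow hUfin hp hdm hd0 hdC hconv'
  set S := fun j => closerSet A B (ψ j) with hS
  have hSm (j) : MeasurableSet (S j) := measurableSet_closerSet A B (ψ j)
  have hSU (j) : S j ⊆ U := Set.inter_subset_left
  have hSmem (j) : volume.real (S j) ∈ Set.Icc 0 Real.pi :=
    ⟨measureReal_nonneg, hUreal ▸ measureReal_mono (hSU j) hUfin⟩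
  obtain ⟨a, ⟨ha0, haπ⟩, φ, hφ, hlim⟩ := isCompact_Icc.tendsto_subseq hSmem
  have hlim' : Tendsto (fun m => volume.real (S (φ m))) atTop (nhds a) := hlim
  refine ⟨φ, hφ, ?_⟩
  have hφt := hφ.tendsto_atTop
  have hD := frob_nonneg (A - B)
  have hnonneg (G : Matrix (Fin 2) (Fin 2) ℝ) (m : ℕ) :
      0 ≤ ∫ x in U, frob (symGradE (ψ (φ m)) x - G) ^ p :=
    integral_nonneg fun x => Real.rpow_nonneg (frob_nonneg _) p
  have hmin (j x) : frob (symGradE (ψ j) x - B) ≤ wellDist A B (ψ j) x + frob (A - B) ∧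
      frob (symGradE (ψ j) x - A) ≤ wellDist A B (ψ j) x + frob (A - B) := by
    have h1 := frob_sub_le (symGradE (ψ j) x) A B
    have h2 := frob_sub_le (symGradE (ψ j) x) B A
    rw [frob_sub_comm B A] at h2
    rw [wellDist]
    rcases min_choice (frob (symGradE (ψ j) x - A)) (frob (symGradE (ψ j) x - B)) with h | h <;>
    · rw [h]
      constructor <;> linarith
  rcases ha0.eq_or_lt with rfl | ha0
  · right
    refine squeeze_zero (hnonneg B) (fun m => setIntegral_rpow_le_of_le_add hUfin (hSm (φ m))
      (hSU (φ m)) hUm hp hD (hdm _) (hd0 _) (hdC _) (measurable_frob_symGradE_sub _ B)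
      (fun _ => frob_nonneg _) (exists_frob_symGradE_sub_le (hK _) B)
      (fun x => (hmin _ x).1) fun x hx hxS =>
        le_min (le_of_not_ge fun h => hxS ⟨hx, h⟩) le_rfl) ?_
    simpa using ((hconv'.comp hφt).const_mul (2 ^ p)).add
      (hlim'.const_mul ((2 * frob (A - B)) ^ p))
  rcases haπ.eq_or_lt with rfl | haπ
  · left
    refine squeeze_zero (hnonneg A) (fun m => setIntegral_rpow_le_of_le_add hUfin
      (hUm.diff (hSm (φ m))) Set.sdiff_subset hUm hp hD (hdm _) (hd0 _) (hdC _)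
      (measurable_frob_symGradE_sub _ A) (fun _ => frob_nonneg _)
      (exists_frob_symGradE_sub_le (hK _) A) (fun x => (hmin _ x).2) fun x hx hxS =>
        le_min le_rfl (not_not.1 fun h => hxS ⟨hx, fun h' => h h'.2⟩)) ?_
    simp_rw [measureReal_sdiff (hSU _) (hSm _) hUfin, hUreal]
    simpa using ((hconv'.comp hφt).const_mul (2 ^ p)).add
      ((hlim'.const_sub Real.pi).const_mul ((2 * frob (A - B)) ^ p))
  exfalso
  have hmean (i j) : a * A i j + (Real.pi - a) * B i j = 0 := by
    have h1 := (hlim'.mul_const (A i j)).add ((hlim'.const_sub Real.pi).mul_const (B i j))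
    refine tendsto_nhds_unique h1 (squeeze_zero_norm (fun m => ?_) (hL1.comp hφt))
    exact abs_average_le_setIntegral_wellDist A B (hK _) (hzero _) i j
  have hdet : 0 < (B 0 0 - A 0 0) * (B 1 1 - A 1 1) - (B 0 1 - A 0 1) ^ 2 := by
    by_contra! h
    obtain ⟨v, w, hvw⟩ := exists_eq_symTensor_of_det_nonpos (hB.sub hA) h
    exact hAB v w hvw
  obtain ⟨M, C, hMC⟩ := exists_shiftedDet_volume_le A B
  have hε (ε : ℝ) (h0 : 0 < ε) (h1 : ε ≤ 1) :
      a * shiftedDet M A + (Real.pi - a) * shiftedDet M B ≤ Real.pi * M ^ 2 + C * ε := by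
    have h2 := (hlim'.mul_const (shiftedDet M A)).add
      ((hlim'.const_sub Real.pi).mul_const (shiftedDet M B))
    refine le_of_tendsto h2 ?_
    filter_upwards [(hL1.comp hφt).eventually_le_const (pow_pos h0 2)] with m hm
    refine hMC ε h0 h1 (K (φ m)) _ (hK _) (hzero _) ?_
    rw [← ofReal_integral_eq_lintegral_ofReal
      (integrableOn_of_measurable_of_bound hUfin (hdm _) (hd0 _) (hdC _))
      (.of_forall fun x => hd0 _ x)]
    exact ENNReal.ofReal_le_ofReal hm
  have hle : a * shiftedDet M A + (Real.pi - a) * shiftedDet M B ≤ Real.pi * M ^ 2 := by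
    have h1 := ((tendsto_one_div_add_atTop_nhds_zero_nat (𝕜 := ℝ)).const_mul C).const_add
      (Real.pi * M ^ 2)
    rw [mul_zero, add_zero] at h1
    refine ge_of_tendsto' h1 fun n => hε _ (by positivity) ?_
    rw [div_le_one (by positivity)]
    linarith [n.cast_nonneg (α := ℝ)]
  have hlt := shiftedDet_add_lt (M := M) ha0 (sub_pos.2 haπ) hmean hdet
  rw [add_sub_cancel] at hlt
  exact absurd hle (not_le.2 hlt)
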